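/- arXiv:1903.08823 — 2 statements merged into one kernel-verified Lean document; each statement's English description precedes it below -/
import Mathlib

section
/- Let β > 0 and define V(s) = e^{−βs/8} ₀F₁(2/β; s/4). With the rescaled variable s_{N,β} = s/(4(N + 1/β)) substituted into the a = 1 gap probability F_N(s) = e^{−βs/8}∑_{p=0}^N ((−N)_p/(p!(2/β)_p))(−s/4N)^p evaluated at 4N s_{N,β} in place of s, one has for each fixed s > 0: N²·(F_N(4N s_{N,β}) − V(s)) → (s/48) e^{−βs/8} ( (−1+1/β) ₀F₁(2/β; s/4) + ((1−1/β) + sβ/8) ₀F₁(2/β + 1; s/4) ) as N → ∞. -/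
open Filter

/-- The rising Pochhammer symbol `(x)_p`. -/
noncomputable def poch (x : ℝ) (p : ℕ) : ℝ := ∏ i ∈ Finset.range p, (x + i)

/-- The hypergeometric function `₀F₁(c; z) = ∑_{p≥0} z^p/(p! (c)_p)`. -/
noncomputable def hyp0F1 (c z : ℝ) : ℝ := ∑' p : ℕ, z ^ p / ((Nat.factorial p) * poch c p)

/-- `V(s) = e^{−βs/8} ₀F₁(2/β; s/4)`. -/
noncomputable def Vfun (β s : ℝ) : ℝ := Real.exp (-β * s / 8) * hyp0F1 (2 / β) (s / 4)

/-- The `a = 1` finite-`N` gap probability evaluated at `s/(4N)`: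
`F_N(s) = e^{−βs/8} ∑_{p=0}^N ((−N)_p/(p! (2/β)_p)) (−s/(4N))^p`. -/
noncomputable def gapF (β : ℝ) (N : ℕ) (s : ℝ) : ℝ :=
  Real.exp (-β * s / 8) *
    ∑ p ∈ Finset.range (N + 1),
      poch (-(N : ℝ)) p / ((Nat.factorial p) * poch (2 / β) p) * (-s / (4 * N)) ^ p


lemma poch_succ (x : ℝ) (p : ℕ) : poch x (p+1) = poch x p * (x + p) := by
  simp [poch, Finset.prod_range_succ]

lemma poch_succ' (x : ℝ) (p : ℕ) : poch x (p+1) = x * poch (x+1) p := by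
  induction p with
  | zero => simp [poch]
  | succ n ih =>
    rw [poch_succ, ih, poch_succ]; push_cast; ring

lemma poch_pos {x : ℝ} (hx : 0 < x) (p : ℕ) : 0 < poch x p := by
  unfold poch
  exact Finset.prod_pos (fun i _ => by positivity)

lemma pow_le_poch {x : ℝ} (hx : 0 < x) (p : ℕ) : x ^ p ≤ poch x p := by
  induction p with
  | zero => simp [poch]
  | succ n ih =>
    rw [poch_succ, pow_succ]
    have : (0:ℝ) ≤ n := by positivity
    have h := poch_pos hx n
    gcongr
    linarith

/-- Terms of the series. -/
noncomputable def uT (c t : ℝ) (p : ℕ) : ℝ := t ^ p / ((Nat.factorial p) * poch c p)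

lemma uT_nonneg {c t : ℝ} (hc : 0 < c) (ht : 0 < t) (p : ℕ) : 0 ≤ uT c t p := by
  have := poch_pos hc p
  unfold uT; positivity

lemma uT_hasSum {c t : ℝ} (hc : 0 < c) (ht : 0 < t) : HasSum (uT c t) (hyp0F1 c t) := by
  apply Summable.hasSum
  refine Summable.of_nonneg_of_le (uT_nonneg hc ht) (fun p => ?_)
    (Real.summable_pow_div_factorial (t / c))
  have h := poch_pos hc p
  have h2 := pow_le_poch hc p
  have h3 : (0:ℝ) < Nat.factorial p := by positivity
  unfold uT
  rw [div_pow, div_div, mul_comm]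
  gcongr

lemma uT_succ {c t : ℝ} (hc : 0 < c) (p : ℕ) :
    ((p:ℝ) + 1) * (c + p) * uT c t (p+1) = t * uT c t p := by
  have h := poch_pos hc p
  have h3 : (0:ℝ) < Nat.factorial p := by positivity
  have h4 : (0:ℝ) < c + p := by positivity
  unfold uT
  rw [poch_succ, Nat.factorial_succ]
  push_cast
  field_simp
  ring

lemma uT_succ' {c t : ℝ} (hc : 0 < c) (p : ℕ) :
    ((p:ℝ) + 1) * uT c t (p+1) = t / c * uT (c+1) t p := by
  have h := poch_pos (show 0 < c + 1 by linarith) p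
  have h3 : (0:ℝ) < Nat.factorial p := by positivity
  unfold uT
  rw [poch_succ', Nat.factorial_succ]
  push_cast
  field_simp
  ring

lemma hasSum_shift {f : ℕ → ℝ} {a : ℝ} (h0 : f 0 = 0) (h : HasSum (fun p => f (p+1)) a) :
    HasSum f a := by
  have := (hasSum_nat_add_iff (f := f) 1).1 h
  simpa [h0] using this

lemma hasSum_conv {f g : ℕ → ℝ} {a a' : ℝ} (h : HasSum f a) (h1 : ∀ p, g p = f p)
    (h2 : a' = a) : HasSum g a' := by
  obtain rfl : g = f := funext h1
  rw [h2]; exact h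

section sums
variable {c t : ℝ}

lemma sum1 (hc : 0 < c) (ht : 0 < t) :
    HasSum (fun p : ℕ => (p:ℝ) * uT c t p) (t / c * hyp0F1 (c+1) t) := by
  apply hasSum_shift (by simp)
  have := (uT_hasSum (show 0 < c + 1 by linarith) ht).mul_left (t / c)
  refine hasSum_conv this (fun p => ?_) rfl
  rw [← uT_succ' hc]; push_cast; ring

lemma sum2 (hc : 0 < c) (ht : 0 < t) :
    HasSum (fun p : ℕ => (p:ℝ) * (c + p - 1) * uT c t p) (t * hyp0F1 c t) := by
  apply hasSum_shift (by simp)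
  refine hasSum_conv ((uT_hasSum hc ht).mul_left t) (fun p => ?_) rfl
  rw [← uT_succ hc]; push_cast; ring

lemma sum3 (hc : 0 < c) (ht : 0 < t) :
    HasSum (fun p : ℕ => (p:ℝ)^2 * (c + p - 1) * uT c t p)
      (t * (t / c * hyp0F1 (c+1) t + hyp0F1 c t)) := by
  apply hasSum_shift (by simp)
  refine hasSum_conv (((sum1 hc ht).add (uT_hasSum hc ht)).mul_left t) (fun p => ?_) rfl
  have := uT_succ (t := t) hc p
  push_cast
  linear_combination ((p:ℝ) + 1) * this

lemma sum4 (hc : 0 < c) (ht : 0 < t) :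
    HasSum (fun p : ℕ => ((p:ℝ) * (c + p - 1))^2 * uT c t p)
      (t * (t * hyp0F1 c t + 2 * (t / c * hyp0F1 (c+1) t) + c * hyp0F1 c t)) := by
  apply hasSum_shift (by simp)
  refine hasSum_conv ((((sum2 hc ht).add ((sum1 hc ht).mul_left 2)).add
    ((uT_hasSum hc ht).mul_left c)).mul_left t) (fun p => ?_) rfl
  have := uT_succ (t := t) hc p
  push_cast
  linear_combination ((p:ℝ) + 1) * (c + p) * this

end sums

noncomputable def e1 (b : ℝ) (p : ℕ) : ℝ := p * (2 * b + p - 1) / 2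

noncomputable def e2 (b : ℝ) (p : ℕ) : ℝ :=
  (e1 b p ^ 2 - (p * b ^ 2 + b * (p * (p - 1)) + (p - 1) * p * (2 * p - 1) / 6)) / 2

lemma e1_succ (b : ℝ) (p : ℕ) : e1 b (p+1) = e1 b p + (b + p) := by
  unfold e1; push_cast; ring

lemma e2_succ (b : ℝ) (p : ℕ) : e2 b (p+1) = e2 b p + (b + p) * e1 b p := by
  unfold e2 e1; push_cast; ring

lemma e1_nonneg {b : ℝ} (hb : 0 < b) (p : ℕ) : 0 ≤ e1 b p := by
  induction p with
  | zero => simp [e1]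
  | succ n ih => rw [e1_succ]; positivity

lemma sum_e1 {b t : ℝ} (hb : 0 < b) (ht : 0 < t) :
    HasSum (fun p => e1 b p * uT (2*b) t p) (t / 2 * hyp0F1 (2*b) t) := by
  refine hasSum_conv ((sum2 (show 0 < 2 * b by linarith) ht).mul_left (1/2)) (fun p => ?_) ?_
  · unfold e1; ring
  · ring

lemma sum_e1sq {b t : ℝ} (hb : 0 < b) (ht : 0 < t) :
    Summable (fun p => e1 b p ^ 2 * uT (2*b) t p) := by
  refine (hasSum_conv ((sum4 (show 0 < 2 * b by linarith) ht).mul_left (1/4))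
    (fun p => ?_) rfl).summable
  unfold e1; ring

lemma sum_e2 {b t : ℝ} (hb : 0 < b) (ht : 0 < t) :
    HasSum (fun p => e2 b p * uT (2*b) t p)
      (t ^ 2 / 8 * hyp0F1 (2*b) t + t * (b - 1) / 12 * hyp0F1 (2*b) t
        + (t / 12 + b * (1 - b) / 6) * (t / (2 * b) * hyp0F1 (2*b+1) t)) := by
  have hc : 0 < 2 * b := by linarith
  refine hasSum_conv (((((sum4 hc ht).mul_left (1/8)).sub ((sum3 hc ht).mul_left (1/6))).add
    ((sum2 hc ht).mul_left ((2*b-1)/6 - (b-1/2)/2))).add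
    ((sum1 hc ht).mul_left (-(2*b-1)*((2*b-1)/6 - (b-1/2)/2) - (1/6-b+b^2)/2))) (fun p => ?_) ?_
  · unfold e2 e1; ring
  · ring

/-- The ratio product. -/
noncomputable def aT (b : ℝ) (N p : ℕ) : ℝ := ∏ i ∈ Finset.range p, (((N:ℝ) - i) / (N + b))

lemma aT_succ (b : ℝ) (N p : ℕ) : aT b N (p+1) = aT b N p * (((N:ℝ) - p) / (N + b)) := by
  rw [aT, Finset.prod_range_succ, aT]

lemma aT_zero_of_lt (b : ℝ) {N p : ℕ} (h : N < p) : aT b N p = 0 := by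
  unfold aT
  exact Finset.prod_eq_zero (Finset.mem_range.2 h) (by simp)

lemma aT_mem {b : ℝ} (hb : 0 < b) (N p : ℕ) : 0 ≤ aT b N p ∧ aT b N p ≤ 1 := by
  rcases lt_or_ge N p with h | h
  · rw [aT_zero_of_lt b h]; simp
  · have key : ∀ i ∈ Finset.range p, (0:ℝ) ≤ ((N:ℝ) - i) / (N + b) ∧
        ((N:ℝ) - i) / (N + b) ≤ 1 := by
      intro i hi
      have : (i:ℝ) ≤ N := by
        have := Finset.mem_range.1 hi
        exact_mod_cast (by omega : i ≤ N)
      have hi0 : (0:ℝ) ≤ i := by positivity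
      have hM : (0:ℝ) < N + b := by positivity
      refine ⟨div_nonneg (by linarith) hM.le, ?_⟩
      rw [div_le_one hM]; linarith
    exact ⟨Finset.prod_nonneg fun i hi => (key i hi).1,
      Finset.prod_le_one (fun i hi => (key i hi).1) (fun i hi => (key i hi).2)⟩

noncomputable def rT (b : ℝ) (N p : ℕ) : ℝ :=
  ((N:ℝ) + b) ^ 2 * (aT b N p - 1 + e1 b p / (N + b))

lemma rT_succ {b : ℝ} (hb : 0 < b) (N p : ℕ) :
    rT b N (p+1) = rT b N p + (b + p) * (((N:ℝ) + b) * (1 - aT b N p)) := by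
  have hM : (0:ℝ) < N + b := by positivity
  unfold rT
  rw [aT_succ, e1_succ]
  field_simp
  ring

lemma aT_eq {b : ℝ} (hb : 0 < b) (N p : ℕ) :
    ((N:ℝ) + b) * (1 - aT b N p) = e1 b p - rT b N p / (N + b) := by
  have hM : (0:ℝ) < N + b := by positivity
  unfold rT
  field_simp
  ring

lemma rT_bound {b : ℝ} (hb : 0 < b) (N p : ℕ) : 0 ≤ rT b N p ∧ rT b N p ≤ e1 b p ^ 2 := by
  have hM : (0:ℝ) < N + b := by positivity
  induction p with
  | zero => simp [rT, aT, e1]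
  | succ n ih =>
    obtain ⟨h1, h2⟩ := ih
    have ha := aT_mem hb N n
    have hx : 0 < b + n := by positivity
    have he := e1_nonneg hb n
    have h3 : 0 ≤ ((N:ℝ) + b) * (1 - aT b N n) := mul_nonneg hM.le (by linarith)
    have h4 : ((N:ℝ) + b) * (1 - aT b N n) ≤ e1 b n := by
      rw [aT_eq hb]
      have : 0 ≤ rT b N n / (N + b) := by positivity
      linarith
    rw [rT_succ hb, e1_succ]
    refine ⟨by positivity, ?_⟩
    have := mul_le_mul_of_nonneg_left h4 hx.le
    nlinarith [mul_nonneg hx.le he]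

lemma tendsto_inv_M (b : ℝ) : Tendsto (fun N : ℕ => ((N:ℝ) + b)⁻¹) atTop (nhds 0) :=
  tendsto_inv_atTop_zero.comp (tendsto_atTop_add_const_right _ _ tendsto_natCast_atTop_atTop)

lemma rT_tendsto {b : ℝ} (hb : 0 < b) (p : ℕ) :
    Tendsto (fun N => rT b N p) atTop (nhds (e2 b p)) := by
  induction p with
  | zero => simp [rT, aT, e1, e2]
  | succ n ih =>
    simp_rw [rT_succ hb, aT_eq hb, e2_succ, div_eq_mul_inv]
    have := ih.add (((ih.mul (tendsto_inv_M b)).const_sub (e1 b n)).const_mul (b + n))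
    simpa using this

lemma R_tendsto {b t : ℝ} (hb : 0 < b) (ht : 0 < t) :
    Tendsto (fun N => ∑' p, rT b N p * uT (2*b) t p) atTop
      (nhds (∑' p, e2 b p * uT (2*b) t p)) := by
  have hc : 0 < 2 * b := by linarith
  refine tendsto_tsum_of_dominated_convergence (sum_e1sq hb ht)
    (fun p => (rT_tendsto hb p).mul_const _) (Eventually.of_forall fun N p => ?_)
  have := rT_bound hb N p
  have hu := uT_nonneg hc ht p
  rw [Real.norm_of_nonneg (mul_nonneg this.1 hu)]
  exact mul_le_mul_of_nonneg_right this.2 hu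

lemma A_eq {b t : ℝ} (hb : 0 < b) (ht : 0 < t) (N : ℕ) :
    ∑ p ∈ Finset.range (N + 1), aT b N p * uT (2*b) t p =
      hyp0F1 (2*b) t - t / 2 * hyp0F1 (2*b) t * ((N:ℝ)+b)⁻¹
        + (∑' p, rT b N p * uT (2*b) t p) * (((N:ℝ)+b)⁻¹)^2 := by
  have hc : 0 < 2 * b := by linarith
  have hM : (0:ℝ) < N + b := by positivity
  have hr : Summable (fun p => rT b N p * uT (2*b) t p) := by
    refine Summable.of_nonneg_of_le (fun p => mul_nonneg (rT_bound hb N p).1 (uT_nonneg hc ht p))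
      (fun p => mul_le_mul_of_nonneg_right (rT_bound hb N p).2 (uT_nonneg hc ht p))
      (sum_e1sq hb ht)
  have h1 := (((uT_hasSum hc ht).sub ((sum_e1 hb ht).mul_right ((N:ℝ)+b)⁻¹))).add
    (hr.hasSum.mul_right ((((N:ℝ)+b)⁻¹)^2))
  have h2 : HasSum (fun p => aT b N p * uT (2*b) t p)
      (∑ p ∈ Finset.range (N + 1), aT b N p * uT (2*b) t p) := by
    apply hasSum_sum_of_ne_finset_zero
    intro p hp
    rw [aT_zero_of_lt b (by simpa using hp)]; simp
  refine h2.unique ?_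
  refine hasSum_conv h1 (fun p => ?_) rfl
  unfold rT
  field_simp
  ring

lemma exp_tendsto (b h : ℝ) (hb : 0 < b) :
    Tendsto (fun N : ℕ => ((N:ℝ)+b)^2 * (Real.exp (h * ((N:ℝ)+b)⁻¹) - 1 - h * ((N:ℝ)+b)⁻¹)) atTop
      (nhds (h^2/2)) := by
  have h0 : Tendsto (fun N : ℕ => h * ((N:ℝ)+b)⁻¹) atTop (nhds 0) := by
    simpa using (tendsto_inv_M b).const_mul h
  rcases eq_or_ne h 0 with rfl | hh
  · simp
  have h1 := ((Real.exp_sub_sum_range_succ_isLittleO_pow 2).comp_tendsto h0).tendsto_div_nhds_zero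
  have h2 := (h1.const_mul (h^2)).add_const (h^2/2)
  simp only [mul_zero, zero_add] at h2
  refine h2.congr fun N => ?_
  have hM : (0:ℝ) < N + b := by positivity
  simp only [Function.comp, Finset.sum_range_succ, Finset.sum_range_zero]
  norm_num [Nat.factorial]
  field_simp
  ring

lemma gapF_eq {β s : ℝ} (hβ : 0 < β) {N : ℕ} (hN : 0 < N) :
    gapF β N (4 * (N : ℝ) * (s / (4 * ((N : ℝ) + 1 / β)))) =
      Real.exp (-β * s / 8) * (Real.exp (s / 4 / 2 * ((N:ℝ)+1/β)⁻¹) *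
        ∑ p ∈ Finset.range (N + 1), aT (1/β) N p * uT (2*(1/β)) (s/4) p) := by
  have hb : 0 < 1 / β := by positivity
  have hN' : (0:ℝ) < N := by exact_mod_cast hN
  have hM : (0:ℝ) < N + 1/β := by positivity
  unfold gapF
  rw [← mul_assoc (Real.exp (-β * s / 8)), ← Real.exp_add]
  congr 1
  · congr 1
    field_simp
    ring
  · refine Finset.sum_congr rfl fun p hp => ?_
    clear hp
    have key : poch (-(N:ℝ)) p * (-(4 * (N : ℝ) * (s / (4 * ((N : ℝ) + 1 / β)))) / (4 * N)) ^ p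
        = aT (1/β) N p * (s/4)^p := by
      induction p with
      | zero => simp [poch, aT]
      | succ n ih =>
        rw [poch_succ, aT_succ, pow_succ, pow_succ]
        have e : (-(N:ℝ) + n) * (-(4 * (N : ℝ) * (s / (4 * ((N : ℝ) + 1 / β)))) / (4 * N)) =
          ((N:ℝ) - n) / (N + 1/β) * (s/4) := by
          generalize (N:ℝ) + 1/β = M at *
          field_simp
          ring
        linear_combination (-(N:ℝ) + n) * (-(4 * (N : ℝ) * (s / (4 * ((N : ℝ) + 1 / β)))) / (4 * N)) * ih
          + aT (1/β) N n * (s/4)^n * e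
    unfold uT
    rw [show 2 * (1/β) = 2/β by ring, div_mul_eq_mul_div, key, mul_div_assoc]

theorem gap_second_order_correction (β s : ℝ) (hβ : 0 < β) (hs : 0 < s) :
    Tendsto (fun N : ℕ =>
        (N : ℝ) ^ 2 *
          (gapF β N (4 * (N : ℝ) * (s / (4 * ((N : ℝ) + 1 / β)))) - Vfun β s))
      atTop
      (nhds ((s / 48) * Real.exp (-β * s / 8) *
        ((-1 + 1 / β) * hyp0F1 (2 / β) (s / 4) +
          ((1 - 1 / β) + s * β / 8) * hyp0F1 (2 / β + 1) (s / 4)))) := by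
  have hb : 0 < 1 / β := by positivity
  have ht : 0 < s / 4 := by positivity
  have hR := R_tendsto hb ht
  rw [(sum_e2 hb ht).tsum_eq] at hR
  have hE := exp_tendsto (1/β) (s/4/2) hb
  have hy := tendsto_inv_M (1/β)
  have hNM : Tendsto (fun N : ℕ => (N:ℝ) * ((N:ℝ) + 1/β)⁻¹) atTop (nhds 1) := by
    have := (hy.const_mul (1/β)).const_sub 1
    simp only [mul_zero, sub_zero] at this
    refine this.congr fun N => ?_
    have hM : (0:ℝ) < N + 1/β := by positivity
    generalize hb' : 1/β = b at *
    field_simp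
    ring
  have hu : Tendsto (fun N : ℕ => s/4/2 * ((N:ℝ) + 1/β)⁻¹) atTop (nhds 0) := by
    simpa using hy.const_mul (s/4/2)
  have hexp : Tendsto (fun N : ℕ => Real.exp (s/4/2 * ((N:ℝ) + 1/β)⁻¹)) atTop (nhds 1) := by
    have := (Real.continuous_exp.tendsto 0).comp hu
    rw [Real.exp_zero] at this
    exact this
  have hyE := hy.mul hE
  have main := ((hNM.pow 2).const_mul (Real.exp (-β * s / 8))).mul
    (((hE.mul_const (hyp0F1 (2*(1/β)) (s/4))).sub
      ((hyE.add_const (s/4/2)).mul_const (s/4/2 * hyp0F1 (2*(1/β)) (s/4)))).add (hexp.mul hR))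
  refine le_trans (main.congr' ?_) (le_of_eq (congrArg nhds ?_))
  · filter_upwards [eventually_gt_atTop 0] with N hN
    rw [gapF_eq hβ hN, A_eq hb ht]
    have hM : (0:ℝ) < N + 1/β := by positivity
    unfold Vfun
    rw [show 2 / β = 2 * (1/β) by ring]
    generalize (∑' p, rT (1/β) N p * uT (2*(1/β)) (s/4) p) = R
    generalize Real.exp (s/4/2 * ((N:ℝ) + 1/β)⁻¹) = E
    generalize hyp0F1 (2*(1/β)) (s/4) = f
    generalize (N:ℝ) + 1/β = M at *
    field_simp
    ring
  · rw [show 2 / β = 2 * (1/β) by ring]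
    generalize hyp0F1 (2*(1/β)) (s/4) = f
    generalize hyp0F1 (2*(1/β)+1) (s/4) = g
    field_simp
    ring
end

section
/- For positive integer N, real a > −1, and β > 0, the normalization constant of the Laguerre β-ensemble satisfies W_{2a/β,β,N} = (2/β)^{N(a+1+β(N−1)/2)} ∏_{j=1}^N Γ(1+2j/β)Γ(1+a+(j−1)β/2)/Γ(1+β/2), i.e. ∫_{(0,∞)^N} ∏_{l=1}^N x_l^a e^{−βx_l/2} ∏_{j<k}|x_k − x_j|^β dx = (2/β)^{N(a+1+β(N−1)/2)} ∏_{j=1}^N Γ(1+jβ/2)Γ(1+a+(j−1)β/2)/Γ(1+β/2). -/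
open MeasureTheory

namespace LagSel

open Real Set Filter Topology

/-- regularised square root of the pair interaction -/
noncomputable def psi (γ ε u : ℝ) : ℝ := (u ^ 2 + ε ^ 2) ^ (γ / 2)

/-- regularised Vandermonde factor -/
noncomputable def V (γ ε : ℝ) {n : ℕ} (x : Fin n → ℝ) : ℝ :=
  ∏ i, ∏ j, if i = j then 1 else psi γ ε (x i - x j)

/-- Laguerre weight with exponents -/
noncomputable def wt {n : ℕ} (c x : Fin n → ℝ) : ℝ := ∏ i, (x i ^ c i * exp (-x i))

/-- Lebesgue measure on the positive orthant -/
noncomputable def mu (n : ℕ) : Measure (Fin n → ℝ) :=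
  Measure.pi (fun _ : Fin n => (volume : Measure ℝ).restrict (Ioi 0))

lemma mu_eq (n : ℕ) : mu n = volume.restrict (univ.pi (fun _ : Fin n => Ioi (0:ℝ))) := by
  rw [mu, ← Measure.restrict_pi_pi, volume_pi]

lemma ae_pos (n : ℕ) : ∀ᵐ x ∂(mu n), ∀ i, 0 < x i := by
  rw [mu_eq]
  filter_upwards [ae_restrict_mem (MeasurableSet.univ_pi (fun _ => measurableSet_Ioi))] with x hx i
  exact hx i (mem_univ i)

lemma psi_nonneg (γ ε u : ℝ) : 0 ≤ psi γ ε u := by unfold psi; positivity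

lemma psi_even (γ ε u : ℝ) : psi γ ε (-u) = psi γ ε u := by simp [psi]

lemma V_nonneg (γ ε : ℝ) {n : ℕ} (x : Fin n → ℝ) : 0 ≤ V γ ε x := by
  unfold V
  refine Finset.prod_nonneg fun i _ => Finset.prod_nonneg fun j _ => ?_
  split_ifs
  · exact zero_le_one
  · exact psi_nonneg _ _ _

lemma wt_nonneg {n : ℕ} (c x : Fin n → ℝ) (hx : ∀ i, 0 < x i) : 0 ≤ wt c x :=
  Finset.prod_nonneg fun i _ => mul_nonneg (rpow_nonneg (hx i).le _) (exp_pos _).le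

lemma psi_le {γ ε : ℝ} (hγ : 0 ≤ γ) (h0 : 0 ≤ ε) (h1 : ε ≤ 1) {x y : ℝ} (hx : 0 ≤ x) (hy : 0 ≤ y) :
    psi γ ε (x - y) ≤ (1 + x) ^ γ * (1 + y) ^ γ := by
  unfold psi
  rw [← mul_rpow (by positivity) (by positivity)]
  have : (x - y) ^ 2 + ε ^ 2 ≤ ((1 + x) * (1 + y)) ^ 2 := by
    have h2 : ε ^ 2 ≤ 1 := by nlinarith
    nlinarith [mul_nonneg hx hy, mul_nonneg (mul_nonneg hx hy) hx, mul_nonneg (mul_nonneg hx hy) hy,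
      mul_nonneg (mul_nonneg hx hy) (mul_nonneg hx hy)]
  calc ((x - y) ^ 2 + ε ^ 2) ^ (γ / 2) ≤ (((1 + x) * (1 + y)) ^ 2) ^ (γ / 2) := by
        apply rpow_le_rpow (by positivity) this (by positivity)
    _ = _ := by
        rw [← rpow_natCast, ← rpow_mul (by positivity)]
        congr 1
        push_cast
        ring

lemma V_le {γ ε : ℝ} (hγ : 0 ≤ γ) (h0 : 0 ≤ ε) (h1 : ε ≤ 1) {n : ℕ} (x : Fin n → ℝ)
    (hx : ∀ i, 0 < x i) : V γ ε x ≤ ∏ i, (1 + x i) ^ (2 * n * γ) := by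
  have key : ∀ i : Fin n, 1 ≤ (1 + x i) ^ γ := fun i =>
    one_le_rpow (by linarith [hx i]) hγ
  calc V γ ε x ≤ ∏ i, ∏ j, ((1 + x i) ^ γ * (1 + x j) ^ γ) := by
        unfold V
        refine Finset.prod_le_prod (fun i _ => Finset.prod_nonneg fun j _ => ?_)
          (fun i _ => Finset.prod_le_prod (fun j _ => ?_) (fun j _ => ?_))
        · split_ifs
          · exact zero_le_one
          · exact psi_nonneg _ _ _
        · split_ifs
          · exact zero_le_one
          · exact psi_nonneg _ _ _
        · split_ifs
          · nlinarith [key i, key j]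
          · exact psi_le hγ h0 h1 (hx i).le (hx j).le
    _ = _ := by
        simp_rw [Finset.prod_mul_distrib, Finset.prod_const, Finset.card_univ, Fintype.card_fin]
        rw [← Finset.prod_pow, ← Finset.prod_mul_distrib]
        refine Finset.prod_congr rfl fun i _ => ?_
        have : 0 < 1 + x i := by linarith [hx i]
        rw [← rpow_natCast, ← rpow_mul this.le, ← rpow_add this]
        congr 1
        ring

lemma integrable_one {c M : ℝ} (hc : -1 < c) (hM : 0 ≤ M) :
    Integrable (fun x : ℝ => x ^ c * exp (-x) * (1 + x) ^ M) (volume.restrict (Ioi 0)) := by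
  have h1 := GammaIntegral_convergent (s := c + 1) (by linarith)
  have h2 := GammaIntegral_convergent (s := c + M + 1) (by linarith)
  have h3 : Integrable (fun x : ℝ => 2 ^ M * (exp (-x) * x ^ (c + 1 - 1) + exp (-x) * x ^ (c + M + 1 - 1)))
    (volume.restrict (Ioi 0)) := (Integrable.add h1 h2).const_mul (2 ^ M)
  refine Integrable.mono' h3 (by fun_prop) ?_
  filter_upwards [ae_restrict_mem measurableSet_Ioi] with x hx
  have hx : 0 < x := hx
  have e1 : (1 + x) ^ M ≤ 2 ^ M * (1 + x ^ M) := by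
    rcases le_total x 1 with h | h
    · calc (1 + x) ^ M ≤ 2 ^ M := rpow_le_rpow (by linarith) (by linarith) hM
        _ ≤ _ := by
          have := rpow_nonneg hx.le M
          have h2 : (0:ℝ) < 2 ^ M := by positivity
          nlinarith
    · calc (1 + x) ^ M ≤ (2 * x) ^ M := rpow_le_rpow (by linarith) (by linarith) hM
        _ = 2 ^ M * x ^ M := mul_rpow (by norm_num) hx.le
        _ ≤ _ := by
          have h2 : (0:ℝ) < 2 ^ M := by positivity
          nlinarith
  rw [norm_of_nonneg (by positivity)]
  have e2 : x ^ (c + M + 1 - 1) = x ^ c * x ^ M := by rw [← rpow_add hx]; congr 1; ring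
  rw [e2, add_sub_cancel_right]
  calc x ^ c * exp (-x) * (1 + x) ^ M ≤ x ^ c * exp (-x) * (2 ^ M * (1 + x ^ M)) := by gcongr
    _ = _ := by ring

/-- dominating function -/
noncomputable def dom (M : ℝ) {n : ℕ} (c x : Fin n → ℝ) : ℝ :=
  ∏ i, (x i ^ c i * exp (-x i) * (1 + x i) ^ M)

lemma integrable_dom {M : ℝ} (hM : 0 ≤ M) {n : ℕ} {c : Fin n → ℝ} (hc : ∀ i, -1 < c i) :
    Integrable (dom M c) (mu n) :=
  Integrable.fintype_prod (f := fun i (x : ℝ) => x ^ c i * exp (-x) * (1 + x) ^ M)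
    (fun i => integrable_one (hc i) hM)

lemma wtV_le {γ ε : ℝ} (hγ : 0 ≤ γ) (h0 : 0 ≤ ε) (h1 : ε ≤ 1) {n : ℕ} (c x : Fin n → ℝ)
    (hx : ∀ i, 0 < x i) : wt c x * V γ ε x ≤ dom (2 * n * γ) c x := by
  unfold dom
  rw [Finset.prod_mul_distrib]
  exact mul_le_mul_of_nonneg_left (V_le hγ h0 h1 x hx) (wt_nonneg c x hx)

lemma measurable_V (γ ε : ℝ) (n : ℕ) : Measurable (fun x : Fin n → ℝ => V γ ε x) := by
  unfold V psi
  refine Finset.measurable_fun_prod _ fun i _ => Finset.measurable_fun_prod _ fun j _ => ?_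
  split_ifs
  · fun_prop
  · fun_prop

lemma measurable_wt {n : ℕ} (c : Fin n → ℝ) : Measurable (fun x : Fin n → ℝ => wt c x) := by
  unfold wt
  fun_prop

lemma integrable_wtV {γ ε : ℝ} (hγ : 0 ≤ γ) (h0 : 0 ≤ ε) (h1 : ε ≤ 1) {n : ℕ} {c : Fin n → ℝ}
    (hc : ∀ i, -1 < c i) : Integrable (fun x => wt c x * V γ ε x) (mu n) := by
  refine Integrable.mono' (integrable_dom (M := 2 * n * γ) (by positivity) hc)
    ((measurable_wt c).mul (measurable_V γ ε n)).aestronglyMeasurable ?_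
  filter_upwards [ae_pos n] with x hx
  rw [norm_of_nonneg (mul_nonneg (wt_nonneg c x hx) (V_nonneg _ _ _))]
  exact wtV_le hγ h0 h1 c x hx

lemma integrable_bdd_wtV {γ ε : ℝ} (hγ : 0 ≤ γ) (h0 : 0 ≤ ε) (h1 : ε ≤ 1) {n : ℕ} {c : Fin n → ℝ}
    (hc : ∀ i, -1 < c i) {f : (Fin n → ℝ) → ℝ} (hf : Measurable f) (B : ℝ) (hB : ∀ x, |f x| ≤ B) :
    Integrable (fun x => f x * (wt c x * V γ ε x)) (mu n) :=
  (integrable_wtV hγ h0 h1 hc).bdd_mul hf.aestronglyMeasurable (ae_of_all _ hB)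

lemma perm_integral {n : ℕ} (σ : Equiv.Perm (Fin n)) (F : (Fin n → ℝ) → ℝ) :
    ∫ x, F (x ∘ σ) ∂(mu n) = ∫ x, F x ∂(mu n) := by
  have h := measurePreserving_piCongrLeft (α := fun _ : Fin n => ℝ)
    (fun _ : Fin n => (volume : Measure ℝ).restrict (Ioi 0)) σ.symm
  have h2 := h.integral_comp' F
  unfold mu
  rw [← h2]
  congr 1
  ext x
  congr 1
  ext i
  obtain ⟨j, rfl⟩ := σ.symm.surjective i
  rw [MeasurableEquiv.coe_piCongrLeft, Equiv.piCongrLeft_apply_apply]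
  simp

lemma V_perm (γ ε : ℝ) {n : ℕ} (σ : Equiv.Perm (Fin n)) (x : Fin n → ℝ) :
    V γ ε (x ∘ σ) = V γ ε x := by
  unfold V
  symm
  rw [← Equiv.prod_comp σ]
  refine Finset.prod_congr rfl fun i _ => ?_
  rw [← Equiv.prod_comp σ]
  refine Finset.prod_congr rfl fun j _ => ?_
  simp

lemma wt_perm {n : ℕ} (σ : Equiv.Perm (Fin n)) (c x : Fin n → ℝ) :
    wt (c ∘ σ) (x ∘ σ) = wt c x := by
  unfold wt
  symm
  rw [← Equiv.prod_comp σ]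
  rfl

lemma V_insertNth (γ ε : ℝ) {m : ℕ} (i : Fin (m + 1)) (t : ℝ) (y : Fin m → ℝ) :
    V γ ε (i.insertNth (α := fun _ => ℝ) t y) = (∏ j, psi γ ε (t - y j) ^ 2) * V γ ε y := by
  unfold V
  rw [Fin.prod_univ_succAbove _ i]
  simp_rw [Fin.prod_univ_succAbove _ i]
  simp only [Fin.insertNth_apply_same, Fin.insertNth_apply_succAbove, if_true,
    Fin.succAbove_ne, Fin.ne_succAbove, if_false, one_mul, Fin.succAbove_right_inj,
    Finset.prod_mul_distrib, Finset.prod_pow]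
  have : ∀ j, psi γ ε (y j - t) = psi γ ε (t - y j) := fun j => by rw [← psi_even, neg_sub]
  simp_rw [this]
  ring

lemma wt_insertNth {m : ℕ} (c : Fin (m + 1) → ℝ) (i : Fin (m + 1)) (t : ℝ) (y : Fin m → ℝ) :
    wt c (i.insertNth (α := fun _ => ℝ) t y) =
      t ^ c i * exp (-t) * wt (fun j => c (i.succAbove j)) y := by
  unfold wt
  rw [Fin.prod_univ_succAbove _ i]
  simp

/-- log-derivative of the interaction -/
noncomputable def w (ε u : ℝ) : ℝ := u / (u ^ 2 + ε ^ 2)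

lemma w_bdd {ε : ℝ} (hε : 0 < ε) (u : ℝ) : |w ε u| ≤ 1 / ε := by
  unfold w
  rw [abs_div, abs_of_pos (by positivity : 0 < u ^ 2 + ε ^ 2), div_le_div_iff₀ (by positivity) hε]
  nlinarith [sq_abs u, sq_nonneg (|u| - ε), abs_nonneg u]

lemma w_odd (ε u : ℝ) : w ε (-u) = - w ε u := by simp [w, neg_div]

lemma measurable_w (ε : ℝ) : Measurable (w ε) := by unfold w; fun_prop

lemma hasDerivAt_psi_sq {γ ε : ℝ} (hε : 0 < ε) (s t : ℝ) :
    HasDerivAt (fun t => psi γ ε (t - s) ^ 2) (psi γ ε (t - s) ^ 2 * (2 * γ * w ε (t - s))) t := by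
  have hp : 0 < (t - s) ^ 2 + ε ^ 2 := by positivity
  have h1 : HasDerivAt (fun t => (t - s) ^ 2 + ε ^ 2) (2 * (t - s)) t := by
    have := (((hasDerivAt_id t).sub_const s).pow 2).add_const (ε ^ 2)
    simpa using this
  have h2 := (h1.rpow_const (p := γ / 2) (Or.inl hp.ne')).pow 2
  have e : psi γ ε (t - s) ^ 2 * (2 * γ * w ε (t - s)) =
    ((2:ℕ):ℝ) * ((t - s) ^ 2 + ε ^ 2) ^ (γ / 2) ^ 1 * (2 * (t - s) * (γ / 2) * ((t - s) ^ 2 + ε ^ 2) ^ (γ / 2 - 1)) := by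
    unfold psi w
    rw [rpow_sub_one hp.ne']
    field_simp
    norm_num
    try ring
  rw [e]
  convert! h2 using 1
  simp

lemma hasDerivAt_prod {ι : Type*} (s : Finset ι) (f : ι → ℝ → ℝ) (g : ι → ℝ) (t : ℝ)
    (h : ∀ i ∈ s, HasDerivAt (f i) (f i t * g i) t) :
    HasDerivAt (fun t => ∏ i ∈ s, f i t) ((∏ i ∈ s, f i t) * ∑ i ∈ s, g i) t := by
  classical
  induction s using Finset.induction_on with
  | empty => simpa using hasDerivAt_const t (1:ℝ)
  | insert a s ha ih =>
    have h1 := (h a (Finset.mem_insert_self a s)).mul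
      (ih (fun i hi => h i (Finset.mem_insert_of_mem hi)))
    simp only [Finset.prod_insert ha, Finset.sum_insert ha]
    convert! h1 using 1
    ring

lemma integral_split {m : ℕ} (i : Fin (m + 1)) (G : (Fin (m + 1) → ℝ) → ℝ)
    (hG : Integrable G (mu (m + 1))) :
    ∫ x, G x ∂(mu (m + 1)) =
      ∫ y, (∫ t in Ioi 0, G (i.insertNth (α := fun _ => ℝ) t y)) ∂(mu m) := by
  have mp := measurePreserving_piFinSuccAbove (α := fun _ : Fin (m + 1) => ℝ)
    (fun _ => (volume : Measure ℝ).restrict (Ioi 0)) i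
  have h1 := mp.symm.integral_comp' G
  have h2 := (mp.symm.integrable_comp_emb (MeasurableEquiv.measurableEmbedding _)).2 hG
  have h3 := integral_prod_symm _ h2
  exact h1.symm.trans h3

lemma integrable_split {m : ℕ} (i : Fin (m + 1)) (G : (Fin (m + 1) → ℝ) → ℝ)
    (hG : Integrable G (mu (m + 1))) :
    ∀ᵐ y ∂(mu m), IntegrableOn (fun t => G (i.insertNth (α := fun _ => ℝ) t y)) (Ioi 0) := by
  have mp := measurePreserving_piFinSuccAbove (α := fun _ : Fin (m + 1) => ℝ)
    (fun _ => (volume : Measure ℝ).restrict (Ioi 0)) i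
  have h2 := (mp.symm.integrable_comp_emb (MeasurableEquiv.measurableEmbedding _)).2 hG
  exact h2.prod_left_ae

lemma wt_shift {n : ℕ} {c c' : Fin n → ℝ} {i : Fin n} (h : ∀ j, j ≠ i → c j = c' j)
    (hi : c i = c' i + 1) {x : Fin n → ℝ} (hx : 0 < x i) : wt c x = x i * wt c' x := by
  unfold wt
  rw [← Finset.mul_prod_erase _ _ (Finset.mem_univ i), ← Finset.mul_prod_erase _ (fun i => x i ^ c' i * _) (Finset.mem_univ i),
    hi, rpow_add hx, rpow_one]
  rw [Finset.prod_congr rfl (g := fun j => x j ^ c' j * exp (-x j))]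
  · ring
  · intro j hj
    rw [h j (Finset.ne_of_mem_erase hj)]

lemma integrable_div {γ ε : ℝ} (hγ : 0 ≤ γ) (h0 : 0 ≤ ε) (h1 : ε ≤ 1) {n : ℕ} {c : Fin n → ℝ}
    (hc : ∀ i, -1 < c i) (i : Fin n) (hi : 0 ≤ c i) :
    Integrable (fun x => c i / x i * (wt c x * V γ ε x)) (mu n) := by
  rcases hi.eq_or_lt with h | h
  · simp [← h]
  · have hc' : ∀ j, -1 < Function.update c i (c i - 1) j := by
      intro j
      by_cases hj : j = i
      · subst hj; simp; linarith
      · simp [hj, hc j]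
    refine ((integrable_wtV hγ h0 h1 hc').const_mul (c i)).congr ?_
    filter_upwards [ae_pos n] with x hx
    rw [wt_shift (c := c) (c' := Function.update c i (c i - 1)) (i := i) _ _ (hx i)]
    · have := (hx i).ne'
      field_simp
    · intro j hj; simp [hj]
    · simp

lemma ibp {γ ε : ℝ} (hγ : 0 ≤ γ) (h0 : 0 < ε) (h1 : ε ≤ 1) {m : ℕ} {c : Fin (m + 1) → ℝ}
    (hc : ∀ i, -1 < c i) (i : Fin (m + 1)) (hi : 0 ≤ c i) :
    ∫ x, (c i / x i * (wt c x * V γ ε x) - wt c x * V γ ε x +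
        ∑ j, (2 * γ * w ε (x i - x (i.succAbove j))) * (wt c x * V γ ε x)) ∂(mu (m + 1)) =
      - ∫ y, (0:ℝ) ^ c i * wt (fun j => c (i.succAbove j)) y *
        ((∏ j, psi γ ε (y j) ^ 2) * V γ ε y) ∂(mu m) := by
  have hF := integrable_wtV hγ h0.le h1 hc
  have hG : Integrable (fun x => c i / x i * (wt c x * V γ ε x) - wt c x * V γ ε x +
        ∑ j, (2 * γ * w ε (x i - x (i.succAbove j))) * (wt c x * V γ ε x)) (mu (m + 1)) := by
    refine ((integrable_div hγ h0.le h1 hc i hi).sub hF).add (integrable_finsetSum _ fun j _ => ?_)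
    refine integrable_bdd_wtV hγ h0.le h1 hc ?_ (2 * γ * (1 / ε)) ?_
    · exact ((measurable_w ε).comp (by fun_prop)).const_mul _
    · intro x
      rw [abs_mul, abs_of_nonneg (by positivity : 0 ≤ 2 * γ)]
      exact mul_le_mul_of_nonneg_left (w_bdd h0 _) (by positivity)
  rw [integral_split i _ hG, ← integral_neg]
  refine integral_congr_ae ?_
  filter_upwards [integrable_split i _ hG, integrable_split i _ hF] with y hGy hFy
  have hder : ∀ t ∈ Ioi (0:ℝ), HasDerivAt (fun t => wt c (i.insertNth (α := fun _ => ℝ) t y) *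
      V γ ε (i.insertNth (α := fun _ => ℝ) t y)) ((fun x => c i / x i * (wt c x * V γ ε x) - wt c x * V γ ε x +
        ∑ j, (2 * γ * w ε (x i - x (i.succAbove j))) * (wt c x * V γ ε x)) (i.insertNth (α := fun _ => ℝ) t y)) t := by
    intro t ht
    have ht : 0 < t := ht
    simp only [V_insertNth, wt_insertNth, Fin.insertNth_apply_same, Fin.insertNth_apply_succAbove]
    have d1 : HasDerivAt (fun t : ℝ => t ^ c i) (c i * t ^ (c i - 1)) t :=
      hasDerivAt_rpow_const (Or.inl ht.ne')
    have d2 : HasDerivAt (fun t : ℝ => exp (-t)) (exp (-t) * (-1)) t := (hasDerivAt_neg t).exp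
    have d3 := hasDerivAt_prod Finset.univ (fun j t => psi γ ε (t - y j) ^ 2)
      (fun j => 2 * γ * w ε (t - y j)) t (fun j _ => hasDerivAt_psi_sq h0 (y j) t)
    have d := ((d1.mul d2).mul_const (wt (fun j => c (i.succAbove j)) y)).mul (d3.mul_const (V γ ε y))
    convert! d using 1
    rw [← Finset.sum_mul, rpow_sub_one ht.ne']
    field_simp
    simp
    ring
  have hlim := tendsto_zero_of_hasDerivAt_of_integrableOn_Ioi hder hGy hFy
  have hcont : ContinuousWithinAt (fun t => wt c (i.insertNth (α := fun _ => ℝ) t y) *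
      V γ ε (i.insertNth (α := fun _ => ℝ) t y)) (Ici 0) 0 := by
    simp only [V_insertNth, wt_insertNth]
    refine ContinuousAt.continuousWithinAt (ContinuousAt.mul ?_ ?_)
    · refine ContinuousAt.mul (ContinuousAt.mul ?_ (by fun_prop)) (by fun_prop)
      exact continuousAt_rpow_const _ _ (Or.inr hi)
    · refine ContinuousAt.mul ?_ (by fun_prop)
      have d3 := hasDerivAt_prod Finset.univ (fun j t => psi γ ε (t - y j) ^ 2)
        (fun j => 2 * γ * w ε (0 - y j)) 0 (fun j _ => hasDerivAt_psi_sq h0 (y j) 0)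
      exact d3.continuousAt
  have := integral_Ioi_of_hasDerivAt_of_tendsto hcont hder hGy hlim
  rw [this]
  simp only [V_insertNth, wt_insertNth, zero_sub, psi_even, neg_zero, exp_zero, mul_one]

lemma swap_zero {γ ε : ℝ} {n : ℕ} {c : Fin n → ℝ} (i j : Fin n) (hij : c i = c j) :
    ∫ x, w ε (x i - x j) * (wt c x * V γ ε x) ∂(mu n) = 0 := by
  have h := perm_integral (Equiv.swap i j) (fun x => w ε (x i - x j) * (wt c x * V γ ε x))
  have hc : c ∘ Equiv.swap i j = c := by
    ext k
    simp only [Function.comp, Equiv.swap_apply_def]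
    split_ifs with h1 h2
    · rw [h1, hij]
    · rw [h2, hij]
    · rfl
  have h2 : ∀ x, wt c (x ∘ Equiv.swap i j) = wt c x := fun x => by
    conv_lhs => rw [← hc]
    exact wt_perm _ c x
  simp only [h2, V_perm] at h
  simp only [Function.comp, Equiv.swap_apply_left, Equiv.swap_apply_right] at h
  have h3 : ∀ x : Fin n → ℝ, w ε (x j - x i) * (wt c x * V γ ε x) =
      -(w ε (x i - x j) * (wt c x * V γ ε x)) := fun x => by
    rw [← neg_sub, w_odd]; ring
  simp only [h3, integral_neg] at h
  linarith

lemma uw_bdd (ε u : ℝ) : |u * w ε u| ≤ 1 := by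
  unfold w
  rw [← mul_div_assoc, abs_div, abs_of_nonneg (by positivity : 0 ≤ u ^ 2 + ε ^ 2),
    abs_of_nonneg (by nlinarith : 0 ≤ u * u)]
  exact div_le_one_of_le₀ (by nlinarith [sq_nonneg ε]) (by positivity)

lemma swap_half {γ ε : ℝ} (hγ : 0 ≤ γ) (h0 : 0 < ε) (h1 : ε ≤ 1) {n : ℕ} {c c' : Fin n → ℝ}
    (hc' : ∀ i, -1 < c' i) (i j : Fin n) (hne : i ≠ j) (hij : c' i = c' j)
    (h : ∀ j, j ≠ i → c j = c' j) (hi : c i = c' i + 1) :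
    ∫ x, w ε (x i - x j) * (wt c x * V γ ε x) ∂(mu n) =
      1 / 2 * ∫ x, ((x i - x j) * w ε (x i - x j)) * (wt c' x * V γ ε x) ∂(mu n) := by
  have hc2 : ∀ k, -1 < c k := fun k => by
    by_cases hk : k = i
    · subst hk; linarith [hc' k]
    · rw [h k hk]; exact hc' k
  have e1 : (fun x => w ε (x i - x j) * (wt c x * V γ ε x)) =ᵐ[mu n]
      (fun x => x i * w ε (x i - x j) * (wt c' x * V γ ε x)) := by
    filter_upwards [ae_pos n] with x hx
    rw [wt_shift h hi (hx i)]; ring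
  have hIntg : Integrable (fun x => x i * w ε (x i - x j) * (wt c' x * V γ ε x)) (mu n) := by
    refine Integrable.congr ?_ e1
    exact integrable_bdd_wtV hγ h0.le h1 hc2 ((measurable_w ε).comp (by fun_prop)) (1 / ε)
      (fun x => w_bdd h0 _)
  rw [integral_congr_ae e1]
  have hp := perm_integral (Equiv.swap i j) (fun x => x i * w ε (x i - x j) * (wt c' x * V γ ε x))
  have hcc : c' ∘ Equiv.swap i j = c' := by
    ext k
    simp only [Function.comp, Equiv.swap_apply_def]
    split_ifs with h1 h2
    · rw [h1, hij]
    · rw [h2, hij]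
    · rfl
  have h2 : ∀ x, wt c' (x ∘ Equiv.swap i j) = wt c' x := fun x => by
    conv_lhs => rw [← hcc]
    exact wt_perm _ c' x
  simp only [h2, V_perm] at hp
  simp only [Function.comp, Equiv.swap_apply_left, Equiv.swap_apply_right] at hp
  have h3 : ∀ x : Fin n → ℝ, x j * w ε (x j - x i) * (wt c' x * V γ ε x) =
      (x i - x j) * w ε (x i - x j) * (wt c' x * V γ ε x)
        - x i * w ε (x i - x j) * (wt c' x * V γ ε x) := fun x => by
    rw [← neg_sub, w_odd]; ring
  simp only [h3] at hp
  rw [integral_sub _ hIntg] at hp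
  · linarith
  · refine integrable_bdd_wtV hγ h0.le h1 hc' ?_ 1 (fun x => uw_bdd ε _)
    exact Measurable.mul (by fun_prop) ((measurable_w ε).comp (by fun_prop))

/-- the unregularised integral -/
noncomputable def I (γ : ℝ) {n : ℕ} (c : Fin n → ℝ) : ℝ := ∫ x, wt c x * V γ 0 x ∂(mu n)

/-- regularisation sequence -/
noncomputable def eps (k : ℕ) : ℝ := 1 / ((k : ℝ) + 1)

lemma eps_pos (k : ℕ) : 0 < eps k := by unfold eps; positivity

lemma eps_le (k : ℕ) : eps k ≤ 1 := by
  unfold eps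
  rw [div_le_one (by positivity)]
  linarith [(Nat.cast_nonneg k : (0:ℝ) ≤ k)]

lemma eps_lim : Tendsto eps atTop (𝓝 0) := tendsto_one_div_add_atTop_nhds_zero_nat

lemma psi_lim {γ : ℝ} (hγ : 0 ≤ γ) (u : ℝ) :
    Tendsto (fun k => psi γ (eps k) u) atTop (𝓝 (psi γ 0 u)) := by
  unfold psi
  refine Tendsto.rpow_const ?_ (Or.inr (by positivity))
  exact (eps_lim.pow 2).const_add _

lemma V_lim {γ : ℝ} (hγ : 0 ≤ γ) {n : ℕ} (x : Fin n → ℝ) :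
    Tendsto (fun k => V γ (eps k) x) atTop (𝓝 (V γ 0 x)) := by
  unfold V
  refine tendsto_finsetProd _ fun i _ => tendsto_finsetProd _ fun j _ => ?_
  split_ifs
  · exact tendsto_const_nhds
  · exact psi_lim hγ _

lemma tendsto_I {γ : ℝ} (hγ : 0 ≤ γ) {n : ℕ} {c : Fin n → ℝ} (hc : ∀ i, -1 < c i) :
    Tendsto (fun k => ∫ x, wt c x * V γ (eps k) x ∂(mu n)) atTop (𝓝 (I γ c)) := by
  refine tendsto_integral_of_dominated_convergence (dom (2 * n * γ) c) (fun k => ?_)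
    (integrable_dom (by positivity) hc) (fun k => ?_) (ae_of_all _ fun x => ?_)
  · exact ((measurable_wt c).mul (measurable_V γ _ n)).aestronglyMeasurable
  · filter_upwards [ae_pos n] with x hx
    rw [norm_of_nonneg (mul_nonneg (wt_nonneg c x hx) (V_nonneg _ _ _))]
    exact wtV_le hγ (eps_pos k).le (eps_le k) c x hx
  · exact (V_lim hγ x).const_mul _

lemma V_zero_of_eq {γ : ℝ} (hγ : 0 < γ) {n : ℕ} {x : Fin n → ℝ} {i j : Fin n} (hne : i ≠ j)
    (h : x i = x j) : V γ 0 x = 0 := by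
  unfold V
  refine Finset.prod_eq_zero (Finset.mem_univ i) (Finset.prod_eq_zero (Finset.mem_univ j) ?_)
  rw [if_neg hne, h]
  unfold psi
  simp
  exact (zero_rpow (by positivity))

lemma tendsto_half {γ : ℝ} (hγ : 0 < γ) {n : ℕ} {c : Fin n → ℝ} (hc : ∀ i, -1 < c i)
    {i j : Fin n} (hne : i ≠ j) :
    Tendsto (fun k => ∫ x, ((x i - x j) * w (eps k) (x i - x j)) * (wt c x * V γ (eps k) x) ∂(mu n))
      atTop (𝓝 (I γ c)) := by
  refine tendsto_integral_of_dominated_convergence (dom (2 * n * γ) c) (fun k => ?_)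
    (integrable_dom (by positivity) hc) (fun k => ?_) (ae_of_all _ fun x => ?_)
  · refine (Measurable.mul ?_ ((measurable_wt c).mul (measurable_V γ _ n))).aestronglyMeasurable
    exact Measurable.mul (by fun_prop) ((measurable_w _).comp (by fun_prop))
  · filter_upwards [ae_pos n] with x hx
    have h0 := mul_nonneg (wt_nonneg c x hx) (V_nonneg γ (eps k) x)
    rw [norm_mul, norm_of_nonneg h0]
    refine le_trans ?_ (wtV_le hγ.le (eps_pos k).le (eps_le k) c x hx)
    exact mul_le_of_le_one_left h0 (uw_bdd _ _)
  · by_cases h : x i = x j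
    · rw [V_zero_of_eq hγ hne h]
      simp [h]
    · have hu : x i - x j ≠ 0 := sub_ne_zero.2 h
      have h1 : Tendsto (fun k => (x i - x j) * w (eps k) (x i - x j)) atTop (𝓝 1) := by
        unfold w
        have : Tendsto (fun k => (x i - x j) * ((x i - x j) / ((x i - x j) ^ 2 + eps k ^ 2))) atTop
          (𝓝 ((x i - x j) * ((x i - x j) / ((x i - x j) ^ 2 + 0 ^ 2)))) := by
          refine Tendsto.const_mul _ (Tendsto.div tendsto_const_nhds ((eps_lim.pow 2).const_add _) ?_)
          simpa using hu
        convert this using 2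
        field_simp
        simp
      have := h1.mul ((V_lim hγ.le x).const_mul (wt c x))
      simpa using this

/-- exponent vector -/
noncomputable def cA (a : ℝ) {n : ℕ} (A : Finset (Fin n)) (k : Fin n) : ℝ :=
  a + if k ∈ A then 1 else 0

lemma aomoto_step {γ a : ℝ} (hγ : 0 < γ) (ha : -1 < a) {m : ℕ} (A : Finset (Fin (m + 1)))
    (i : Fin (m + 1)) (hi : i ∉ A) :
    I γ (cA a (insert i A)) = (a + 1 + γ * (m - A.card)) * I γ (cA a A) := by
  set c := cA a (insert i A) with hcdef
  set c' := cA a A with hcdef'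
  have hc : ∀ k, -1 < c k := fun k => by
    simp only [hcdef, cA]; split_ifs <;> linarith
  have hc' : ∀ k, -1 < c' k := fun k => by
    simp only [hcdef', cA]; split_ifs <;> linarith
  have hci : c i = a + 1 := by simp [hcdef, cA]
  have hci' : c' i = a := by simp [hcdef', cA, hi]
  have hne : ∀ j, j ≠ i → c j = c' j := fun j hj => by simp [hcdef, hcdef', cA, hj]
  have hii : c i = c' i + 1 := by rw [hci, hci']
  have key : ∀ k, (a + 1) * ∫ x, wt c' x * V γ (eps k) x ∂(mu (m + 1)) =
      ∫ x, wt c x * V γ (eps k) x ∂(mu (m + 1)) -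
      ∑ j : Fin m, if i.succAbove j ∈ A then 0 else
        γ * ∫ x, ((x i - x (i.succAbove j)) * w (eps k) (x i - x (i.succAbove j))) *
          (wt c' x * V γ (eps k) x) ∂(mu (m + 1)) := by
    intro k
    have h := ibp hγ.le (eps_pos k) (eps_le k) hc i (by rw [hci]; linarith)
    have hF := integrable_wtV hγ.le (eps_pos k).le (eps_le k) hc
    have hD := integrable_div hγ.le (eps_pos k).le (eps_le k) hc i (by rw [hci]; linarith)
    have hW : ∀ j ∈ (Finset.univ : Finset (Fin m)), Integrable (fun x => (2 * γ * w (eps k) (x i - x (i.succAbove j))) *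
        (wt c x * V γ (eps k) x)) (mu (m + 1)) := by
      intro j _
      refine integrable_bdd_wtV hγ.le (eps_pos k).le (eps_le k) hc ?_ (2 * γ * (1 / eps k)) ?_
      · exact ((measurable_w _).comp (by fun_prop)).const_mul _
      · intro x
        rw [abs_mul, abs_of_nonneg (by positivity : 0 ≤ 2 * γ)]
        exact mul_le_mul_of_nonneg_left (w_bdd (eps_pos k) _) (by positivity)
    have hDF : Integrable (fun x => c i / x i * (wt c x * V γ (eps k) x) - wt c x * V γ (eps k) x)
      (mu (m + 1)) := hD.sub hF
    rw [integral_add hDF (integrable_finsetSum _ hW), integral_sub hD hF,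
      integral_finsetSum _ hW, hci, zero_rpow (by linarith)] at h
    simp only [zero_mul, integral_zero, neg_zero] at h
    have e1 : ∫ x, (a + 1) / x i * (wt c x * V γ (eps k) x) ∂(mu (m + 1)) =
        (a + 1) * ∫ x, wt c' x * V γ (eps k) x ∂(mu (m + 1)) := by
      rw [← integral_const_mul]
      refine integral_congr_ae ?_
      filter_upwards [ae_pos (m + 1)] with x hx
      rw [wt_shift hne hii (hx i)]
      have := (hx i).ne'
      field_simp
    have e2 : ∀ j : Fin m, ∫ x, (2 * γ * w (eps k) (x i - x (i.succAbove j))) *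
        (wt c x * V γ (eps k) x) ∂(mu (m + 1)) = if i.succAbove j ∈ A then 0 else
        γ * ∫ x, ((x i - x (i.succAbove j)) * w (eps k) (x i - x (i.succAbove j))) *
          (wt c' x * V γ (eps k) x) ∂(mu (m + 1)) := by
      intro j
      simp_rw [mul_assoc (2 * γ)]
      rw [integral_const_mul]
      split_ifs with hj
      · rw [swap_zero, mul_zero]
        rw [hci]
        simp [hcdef, cA, hj]
      · rw [swap_half hγ.le (eps_pos k) (eps_le k) hc' i (i.succAbove j) (Fin.succAbove_ne i j).symm
          (by simp [hcdef', cA, hi, hj]) hne hii]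
        ring
    rw [e1, Finset.sum_congr rfl (fun j _ => e2 j)] at h
    linarith
  have l1 := (tendsto_I hγ.le hc').const_mul (a + 1)
  have l2 : Tendsto (fun k => ∫ x, wt c x * V γ (eps k) x ∂(mu (m + 1)) -
      ∑ j : Fin m, if i.succAbove j ∈ A then 0 else
        γ * ∫ x, ((x i - x (i.succAbove j)) * w (eps k) (x i - x (i.succAbove j))) *
          (wt c' x * V γ (eps k) x) ∂(mu (m + 1))) atTop
      (𝓝 (I γ c - ∑ j : Fin m, if i.succAbove j ∈ A then 0 else γ * I γ c')) := by
    refine (tendsto_I hγ.le hc).sub (tendsto_finsetSum _ fun j _ => ?_)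
    split_ifs
    · exact tendsto_const_nhds
    · exact (tendsto_half hγ hc' (Fin.succAbove_ne i j).symm).const_mul γ
  simp only [key] at l1
  have heq := tendsto_nhds_unique l1 l2
  have hsum := Fin.sum_univ_succAbove (fun j : Fin (m + 1) => if j ∈ A then 0 else γ * I γ c') i
  simp only [hi, if_false] at hsum
  have hs2 : ∑ j : Fin (m + 1), (if j ∈ A then 0 else γ * I γ c') = (m + 1 - A.card) * (γ * I γ c') := by
    have : ∀ j : Fin (m + 1), (if j ∈ A then 0 else γ * I γ c') = γ * I γ c' - if j ∈ A then γ * I γ c' else 0 := by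
      intro j; split_ifs <;> simp
    simp_rw [this]
    rw [Finset.sum_sub_distrib]
    simp
    ring
  rw [hs2] at hsum
  linarith

lemma aomoto {γ a : ℝ} (hγ : 0 < γ) (ha : -1 < a) {m : ℕ} (A : Finset (Fin (m + 1))) :
    I γ (cA a A) = (∏ k ∈ Finset.range A.card, (a + 1 + γ * (m - k))) * I γ (cA a (∅ : Finset (Fin (m + 1)))) := by
  induction A using Finset.induction_on with
  | empty => simp
  | insert i A hi ih =>
    rw [aomoto_step hγ ha A i hi, ih, Finset.card_insert_of_notMem hi, Finset.prod_range_succ]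
    ring

/-- equal exponents -/
noncomputable def J (γ : ℝ) (n : ℕ) (a : ℝ) : ℝ := I γ (fun _ : Fin n => a)

lemma J_succ {γ a : ℝ} (hγ : 0 < γ) (ha : -1 < a) (n : ℕ) :
    J γ n (a + 1) = (∏ k ∈ Finset.range n, (a + 1 + k * γ)) * J γ n a := by
  rcases n with _ | m
  · simp only [Finset.range_zero, Finset.prod_empty, one_mul]
    unfold J
    congr 1
    ext i
    exact i.elim0
  · have h := aomoto hγ ha (Finset.univ : Finset (Fin (m + 1)))
    have e1 : cA a (Finset.univ : Finset (Fin (m + 1))) = fun _ => a + 1 := by ext; simp [cA]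
    have e2 : cA a (∅ : Finset (Fin (m + 1))) = fun _ => a := by ext; simp [cA]
    rw [e1, e2] at h
    unfold J
    rw [h, ← Finset.prod_range_reflect]
    congr 1
    simp only [Finset.card_univ, Fintype.card_fin]
    refine Finset.prod_congr rfl fun k hk => ?_
    have : k ≤ m := by simpa [Nat.lt_succ_iff] using hk
    rw [show m + 1 - 1 - k = m - k by omega, Nat.cast_sub this]
    ring

lemma psi_sq_le {γ ε : ℝ} (hγ : 0 ≤ γ) (h0 : 0 ≤ ε) (h1 : ε ≤ 1) {y : ℝ} (hy : 0 < y) :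
    psi γ ε y ^ 2 ≤ (1 + y) ^ (2 * γ) := by
  have h := psi_le hγ h0 h1 hy.le le_rfl
  simp at h
  calc psi γ ε y ^ 2 ≤ ((1 + y) ^ γ) ^ 2 := pow_le_pow_left₀ (psi_nonneg _ _ _) h 2
    _ = _ := by rw [← rpow_natCast, ← rpow_mul (by linarith)]; congr 1; push_cast; ring

lemma J_zero {γ : ℝ} (hγ : 0 < γ) (m : ℕ) : J γ (m + 1) 0 = J γ m (2 * γ) := by
  have hc : ∀ i : Fin (m + 1), -1 < (fun _ : Fin (m + 1) => (0:ℝ)) i := fun i => by simp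
  have hc2 : ∀ i : Fin m, -1 < (fun _ : Fin m => (0:ℝ)) i := fun i => by simp
  have key : ∀ k, ∫ x, wt (fun _ => 0) x * V γ (eps k) x ∂(mu (m + 1)) =
      ∫ y, wt (fun _ => 0) y * ((∏ j, psi γ (eps k) (y j) ^ 2) * V γ (eps k) y) ∂(mu m) := by
    intro k
    have h := ibp hγ.le (eps_pos k) (eps_le k) hc 0 le_rfl
    have hF := integrable_wtV hγ.le (eps_pos k).le (eps_le k) hc
    have hW : ∀ j ∈ (Finset.univ : Finset (Fin m)), Integrable (fun x => (2 * γ * w (eps k) (x 0 - x (Fin.succAbove 0 j))) *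
        (wt (fun _ => 0) x * V γ (eps k) x)) (mu (m + 1)) := by
      intro j _
      refine integrable_bdd_wtV hγ.le (eps_pos k).le (eps_le k) hc ?_ (2 * γ * (1 / eps k)) ?_
      · exact ((measurable_w _).comp (by fun_prop)).const_mul _
      · intro x
        rw [abs_mul, abs_of_nonneg (by positivity : 0 ≤ 2 * γ)]
        exact mul_le_mul_of_nonneg_left (w_bdd (eps_pos k) _) (by positivity)
    have e2 : ∀ j : Fin m, ∫ x, (2 * γ * w (eps k) (x 0 - x (Fin.succAbove 0 j))) *
        (wt (fun _ => 0) x * V γ (eps k) x) ∂(mu (m + 1)) = 0 := by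
      intro j
      simp_rw [mul_assoc (2 * γ)]
      rw [integral_const_mul, swap_zero, mul_zero]
      rfl
    simp only [zero_div, zero_mul, zero_sub, rpow_zero, one_mul] at h
    rw [integral_add hF.fun_neg (integrable_finsetSum _ hW), integral_neg,
      integral_finsetSum _ hW, Finset.sum_congr rfl (fun j _ => e2 j)] at h
    simp only [Finset.sum_const_zero, add_zero, neg_inj] at h
    exact h
  have l1 := tendsto_I hγ.le hc
  simp only [key] at l1
  refine tendsto_nhds_unique l1 ?_
  have e : J γ m (2 * γ) = ∫ y, wt (fun _ => 0) y * ((∏ j, psi γ 0 (y j) ^ 2) * V γ 0 y) ∂(mu m) := by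
    unfold J I
    refine integral_congr_ae ?_
    filter_upwards [ae_pos m] with x hx
    rw [← mul_assoc]
    congr 1
    unfold wt
    rw [← Finset.prod_mul_distrib]
    refine Finset.prod_congr rfl fun i _ => ?_
    have : psi γ 0 (x i) ^ 2 = x i ^ (2 * γ) := by
      unfold psi
      have hxi := (hx i).le
      rw [zero_pow two_ne_zero, add_zero, ← rpow_natCast, ← rpow_natCast, ← rpow_mul hxi, ← rpow_mul hxi]
      congr 1; push_cast; ring
    rw [this, rpow_zero]
    ring
  rw [e]
  refine tendsto_integral_of_dominated_convergence (dom (2 * γ + 2 * m * γ) (fun _ : Fin m => 0)) (fun k => ?_)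
    (integrable_dom (by positivity) hc2) (fun k => ?_) (ae_of_all _ fun x => ?_)
  · refine ((measurable_wt _).mul (Measurable.mul ?_ (measurable_V γ _ m))).aestronglyMeasurable
    unfold psi
    fun_prop
  · filter_upwards [ae_pos m] with x hx
    have hP : 0 ≤ ∏ j, psi γ (eps k) (x j) ^ 2 := Finset.prod_nonneg fun j _ => sq_nonneg _
    rw [norm_of_nonneg (mul_nonneg (wt_nonneg _ x hx) (mul_nonneg hP (V_nonneg _ _ _)))]
    unfold dom
    rw [Finset.prod_mul_distrib]
    refine mul_le_mul_of_nonneg_left ?_ (wt_nonneg _ x hx)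
    have e3 : ∏ i, (1 + x i) ^ (2 * γ + 2 * m * γ) =
        (∏ i, (1 + x i) ^ (2 * γ)) * ∏ i, (1 + x i) ^ (2 * m * γ) := by
      rw [← Finset.prod_mul_distrib]
      refine Finset.prod_congr rfl fun i _ => ?_
      rw [rpow_add (by linarith [hx i])]
    rw [e3]
    refine mul_le_mul ?_ (V_le hγ.le (eps_pos k).le (eps_le k) x hx) (V_nonneg _ _ _) ?_
    · exact Finset.prod_le_prod (fun j _ => sq_nonneg _)
        (fun j _ => psi_sq_le hγ.le (eps_pos k).le (eps_le k) (hx j))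
    · exact Finset.prod_nonneg fun j _ => rpow_nonneg (by linarith [hx j]) _
  · refine Tendsto.const_mul _ (Tendsto.mul ?_ (V_lim hγ.le x))
    exact tendsto_finsetProd _ fun j _ => (psi_lim hγ.le _).pow 2

lemma holder_geom {α : Type*} [MeasurableSpace α] {μ : Measure α} {f g : α → ℝ}
    (hf : Integrable f μ) (hg : Integrable g μ) (hf0 : 0 ≤ᵐ[μ] f) (hg0 : 0 ≤ᵐ[μ] g)
    {a b : ℝ} (ha : 0 < a) (hb : 0 < b) (hab : a + b = 1) :
    ∫ x, f x ^ a * g x ^ b ∂μ ≤ (∫ x, f x ∂μ) ^ a * (∫ x, g x ∂μ) ^ b := by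
  have e : HolderConjugate (1 / a) (1 / b) := Real.holderConjugate_one_div ha hb hab
  have mem : ∀ {c : ℝ} {f : α → ℝ}, 0 < c → Integrable f μ → 0 ≤ᵐ[μ] f →
      MemLp (fun x => f x ^ c) (ENNReal.ofReal (1 / c)) μ := by
    intro c f hc hf hf0
    have A : ENNReal.ofReal (1 / c) ≠ 0 := by
      rwa [Ne, ENNReal.ofReal_eq_zero, not_le, one_div_pos]
    have B : ENNReal.ofReal (1 / c) ≠ ⊤ := ENNReal.ofReal_ne_top
    rw [← memLp_norm_rpow_iff _ A B, ENNReal.toReal_ofReal (one_div_nonneg.mpr hc.le),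
      ENNReal.div_self A B, memLp_one_iff_integrable]
    · apply Integrable.congr hf
      filter_upwards [hf0] with x hx
      have hx : 0 ≤ f x := hx
      rw [norm_of_nonneg (rpow_nonneg hx _), ← rpow_mul hx, mul_one_div_cancel hc.ne', rpow_one]
    · exact (hf.aestronglyMeasurable.aemeasurable.pow_const c).aestronglyMeasurable
  have h := integral_mul_le_Lp_mul_Lq_of_nonneg e (f := fun x => f x ^ a) (g := fun x => g x ^ b)
    (by filter_upwards [hf0] with x hx using rpow_nonneg hx _)
    (by filter_upwards [hg0] with x hx using rpow_nonneg hx _) (mem ha hf hf0) (mem hb hg hg0)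
  have e1 : ∫ x, (f x ^ a) ^ (1 / a) ∂μ = ∫ x, f x ∂μ := by
    refine integral_congr_ae ?_
    filter_upwards [hf0] with x hx
    have hx : 0 ≤ f x := hx
    rw [← rpow_mul hx, mul_one_div_cancel ha.ne', rpow_one]
  have e2 : ∫ x, (g x ^ b) ^ (1 / b) ∂μ = ∫ x, g x ∂μ := by
    refine integral_congr_ae ?_
    filter_upwards [hg0] with x hx
    have hx : 0 ≤ g x := hx
    rw [← rpow_mul hx, mul_one_div_cancel hb.ne', rpow_one]
  rwa [e1, e2, one_div_one_div, one_div_one_div] at h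

lemma wtV_nonneg (γ : ℝ) {n : ℕ} (c : Fin n → ℝ) : 0 ≤ᵐ[mu n] fun x => wt c x * V γ 0 x := by
  filter_upwards [ae_pos n] with x hx
  exact mul_nonneg (wt_nonneg c x hx) (V_nonneg _ _ _)

lemma J_nonneg (γ : ℝ) (n : ℕ) (a : ℝ) : 0 ≤ J γ n a := integral_nonneg_of_ae (wtV_nonneg γ _)

lemma J_convex {γ : ℝ} (hγ : 0 < γ) (n : ℕ) (s t θ η : ℝ) (hs : -1 < s) (ht : -1 < t) (hθ : 0 < θ)
    (hη : 0 < η) (h : θ + η = 1) : J γ n (θ * s + η * t) ≤ J γ n s ^ θ * J γ n t ^ η := by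
  have key := holder_geom (integrable_wtV hγ.le le_rfl zero_le_one (c := fun _ : Fin n => s) (fun _ => hs))
    (integrable_wtV hγ.le le_rfl zero_le_one (c := fun _ : Fin n => t) (fun _ => ht))
    (wtV_nonneg γ _) (wtV_nonneg γ _) hθ hη h
  refine le_trans (le_of_eq ?_) key
  unfold J I
  refine integral_congr_ae ?_
  filter_upwards [ae_pos n] with x hx
  have hV := V_nonneg γ 0 x
  rw [mul_rpow (wt_nonneg _ x hx) hV, mul_rpow (wt_nonneg _ x hx) hV]
  have e1 : V γ 0 x = V γ 0 x ^ θ * V γ 0 x ^ η := by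
    rw [← rpow_add_of_nonneg hV hθ.le hη.le, h, rpow_one]
  have e2 : wt (fun _ => θ * s + η * t) x = wt (fun _ => s) x ^ θ * wt (fun _ => t) x ^ η := by
    unfold wt
    have hnn : ∀ (c : ℝ) (i : Fin n), i ∈ Finset.univ → 0 ≤ x i ^ c * exp (-x i) := fun c i _ =>
      mul_nonneg (rpow_nonneg (hx i).le _) (exp_pos _).le
    rw [← finsetProd_rpow _ _ (hnn s), ← finsetProd_rpow _ _ (hnn t), ← Finset.prod_mul_distrib]
    refine Finset.prod_congr rfl fun i _ => ?_
    have hi := hx i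
    rw [mul_rpow (rpow_nonneg hi.le _) (exp_pos _).le, mul_rpow (rpow_nonneg hi.le _) (exp_pos _).le,
      ← rpow_mul hi.le, ← rpow_mul hi.le, ← exp_mul, ← exp_mul, rpow_add hi]
    have : exp (-x i) = exp (-x i * θ) * exp (-x i * η) := by
      rw [← exp_add, ← mul_add, h, mul_one]
    rw [this, mul_comm θ, mul_comm η]
    ring
  rw [e2]
  nth_rewrite 1 [e1]
  ring

lemma iter {F g : ℝ → ℝ} (hFs : ∀ s, -1 < s → F (s + 1) = g s * F s) {x : ℝ} (hx : -1 < x) (k : ℕ) :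
    F (x + k) = (∏ i ∈ Finset.range k, g (x + i)) * F x := by
  induction k with
  | zero => simp
  | succ k ih =>
    have hk : (0:ℝ) ≤ k := Nat.cast_nonneg k
    rw [Finset.prod_range_succ, Nat.cast_succ, ← add_assoc, hFs _ (by linarith), ih]
    ring

lemma bm_le {F G g : ℝ → ℝ} (hF0 : 0 < F 0) (hG0 : 0 < G 0)
    (hFs : ∀ s, -1 < s → F (s + 1) = g s * F s) (hGs : ∀ s, -1 < s → G (s + 1) = g s * G s)
    (hg : ∀ s, -1 < s → 0 < g s)
    (hFc : ∀ s t θ η, -1 < s → -1 < t → 0 < θ → 0 < η → θ + η = 1 →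
      F (θ * s + η * t) ≤ F s ^ θ * F t ^ η)
    (hGc : ∀ s t θ η, -1 < s → -1 < t → 0 < θ → 0 < η → θ + η = 1 →
      G (θ * s + η * t) ≤ G s ^ θ * G t ^ η)
    (hGn : ∀ s, 0 ≤ G s)
    (hr : Tendsto (fun k : ℕ => g ((k : ℝ) + 1) / g k) atTop (𝓝 1))
    {x : ℝ} (hx0 : 0 < x) (hx1 : x < 1) : F x * G 0 ≤ G x * F 0 := by
  have main : ∀ l : ℕ, F x * G 0 ≤ G x * F 0 * (g ((l : ℝ) + 1) / g l) ^ x := by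
    intro l
    have hl : (0:ℝ) ≤ l := Nat.cast_nonneg l
    set k : ℝ := (l : ℝ) + 1 with hk
    have gk : 0 < g k := hg _ (by linarith)
    have gl : 0 < g l := hg _ (by linarith)
    have Q : 0 < ∏ i ∈ Finset.range (l + 1), g (0 + i) := Finset.prod_pos fun i _ =>
      hg _ (by linarith [(Nat.cast_nonneg i : (0:ℝ) ≤ i)])
    have Q' : 0 < ∏ i ∈ Finset.range l, g (0 + i) := Finset.prod_pos fun i _ =>
      hg _ (by linarith [(Nat.cast_nonneg i : (0:ℝ) ≤ i)])
    have P : 0 < ∏ i ∈ Finset.range (l + 1), g (x + i) := Finset.prod_pos fun i _ =>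
      hg _ (by linarith [(Nat.cast_nonneg i : (0:ℝ) ≤ i)])
    have F1 := iter hFs (x := x) (by linarith) (l + 1)
    have G1 := iter hGs (x := x) (by linarith) (l + 1)
    have F2 := iter hFs (x := 0) (by linarith) (l + 1)
    have G2 := iter hGs (x := 0) (by linarith) (l + 1)
    have G3 := iter hGs (x := 0) (by linarith) l
    have kc : ((l + 1 : ℕ) : ℝ) = k := by rw [hk]; push_cast; rfl
    rw [kc] at F1 G1 F2 G2
    rw [zero_add] at F2 G2 G3
    have Fk : 0 < F k := by rw [F2]; positivity
    have Gk : 0 < G k := by rw [G2]; positivity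
    have Gl : 0 < G l := by rw [G3]; positivity
    have up : F (x + k) ≤ F k * g k ^ x := by
      have := hFc k (k + 1) (1 - x) x (by linarith) (by linarith) (by linarith) hx0 (by ring)
      rw [hFs k (by linarith), mul_rpow gk.le Fk.le] at this
      calc F (x + k) = F ((1 - x) * k + x * (k + 1)) := by congr 1; ring
        _ ≤ _ := this
        _ = F k ^ (1 - x) * F k ^ x * g k ^ x := by ring
        _ = _ := by rw [← rpow_add Fk]; simp
    have lo : G k * g l ^ x ≤ G (x + k) := by
      have h1 := hGc l (x + k) (x / (1 + x)) (1 / (1 + x)) (by linarith) (by linarith) (by positivity)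
        (by positivity) (by field_simp; ring)
      have e : x / (1 + x) * l + 1 / (1 + x) * (x + k) = k := by
        field_simp; rw [hk]; ring
      rw [e] at h1
      have h2 := rpow_le_rpow Gk.le h1 (by linarith : 0 ≤ 1 + x)
      rw [mul_rpow (rpow_nonneg Gl.le _) (rpow_nonneg (hGn _) _), ← rpow_mul Gl.le, ← rpow_mul (hGn _),
        div_mul_cancel₀ _ (by linarith), div_mul_cancel₀ _ (by linarith), rpow_one,
        rpow_add Gk, rpow_one] at h2
      have e3 : G k = g l * G l := hGs l (by linarith)
      have e4 : G k ^ x = g l ^ x * G l ^ x := by rw [e3, mul_rpow gl.le Gl.le]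
      rw [e4] at h2
      have : 0 < G l ^ x := rpow_pos_of_pos Gl x
      nlinarith
    have hgx : 0 < g l ^ x := rpow_pos_of_pos gl x
    have comb : F (x + k) * (G k * g l ^ x) ≤ (F k * g k ^ x) * G (x + k) :=
      mul_le_mul up lo (by positivity) (by positivity)
    rw [div_rpow gk.le gl.le, ← mul_div_assoc, le_div_iff₀ hgx]
    rw [F1, G1, F2, G2] at comb
    refine le_of_mul_le_mul_left ?_ (mul_pos P Q)
    calc _ = _ := ?_
      _ ≤ _ := comb
      _ = _ := ?_
    · ring
    · ring
  have lim : Tendsto (fun l : ℕ => G x * F 0 * (g ((l : ℝ) + 1) / g l) ^ x) atTop (𝓝 (G x * F 0 * 1 ^ x)) :=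
    (hr.rpow_const (Or.inl one_ne_zero)).const_mul _
  rw [one_rpow, mul_one] at lim
  exact ge_of_tendsto' lim main

lemma bm {F G g : ℝ → ℝ} (hF0 : 0 < F 0) (hG0 : 0 < G 0)
    (hFs : ∀ s, -1 < s → F (s + 1) = g s * F s) (hGs : ∀ s, -1 < s → G (s + 1) = g s * G s)
    (hg : ∀ s, -1 < s → 0 < g s)
    (hFc : ∀ s t θ η, -1 < s → -1 < t → 0 < θ → 0 < η → θ + η = 1 →
      F (θ * s + η * t) ≤ F s ^ θ * F t ^ η)
    (hGc : ∀ s t θ η, -1 < s → -1 < t → 0 < θ → 0 < η → θ + η = 1 →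
      G (θ * s + η * t) ≤ G s ^ θ * G t ^ η)
    (hFn : ∀ s, 0 ≤ F s) (hGn : ∀ s, 0 ≤ G s)
    (hr : Tendsto (fun k : ℕ => g ((k : ℝ) + 1) / g k) atTop (𝓝 1))
    {s : ℝ} (hs : -1 < s) : F s * G 0 = G s * F 0 := by
  have unit : ∀ x, 0 ≤ x → x < 1 → F x * G 0 = G x * F 0 := by
    intro x hx0 hx1
    rcases hx0.eq_or_lt with h | h
    · rw [← h, mul_comm]
    · exact le_antisymm (bm_le hF0 hG0 hFs hGs hg hFc hGc hGn hr h hx1)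
        (bm_le hG0 hF0 hGs hFs hg hGc hFc hFn hr h hx1)
  rcases lt_or_ge s 0 with h | h
  · have := unit (s + 1) (by linarith) (by linarith)
    rw [hFs s hs, hGs s hs] at this
    refine mul_left_cancel₀ (hg s hs).ne' ?_
    linarith
  · have h1 := unit (Int.fract s) (Int.fract_nonneg s) (Int.fract_lt_one s)
    have e : s = Int.fract s + (⌊s⌋₊ : ℝ) := by
      rw [natCast_floor_eq_intCast_floor h]; exact (Int.fract_add_floor s).symm
    have hf : -1 < Int.fract s := by linarith [Int.fract_nonneg s]
    rw [e, iter hFs hf, iter hGs hf, mul_assoc, h1, mul_assoc]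

/-- the comparison product of Gamma functions -/
noncomputable def Gp (γ : ℝ) (n : ℕ) (a : ℝ) : ℝ := ∏ k ∈ Finset.range n, Gamma (1 + a + k * γ)

lemma J_eval {γ : ℝ} (hγ : 0 < γ) (n : ℕ) : ∀ a, -1 < a →
    J γ n a = (∏ j ∈ Finset.range n, Gamma (1 + (j + 1) * γ) / Gamma (1 + γ)) * Gp γ n a := by
  induction n with
  | zero =>
    intro a _
    simp [J, I, Gp, wt, V, mu, Measure.real]
  | succ m ih =>
    intro a ha
    have Gpos : ∀ n a, -1 < a → 0 < Gp γ n a := fun n a ha => Finset.prod_pos fun k _ =>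
      Gamma_pos_of_pos (by have : 0 ≤ k * γ := by positivity
                           linarith)
    have Cpos : ∀ n : ℕ, 0 < ∏ j ∈ Finset.range n, Gamma (1 + (j + 1) * γ) / Gamma (1 + γ) := fun n =>
      Finset.prod_pos fun k _ => div_pos (Gamma_pos_of_pos (by positivity)) (Gamma_pos_of_pos (by positivity))
    have h0 : J γ (m + 1) 0 = _ := (J_zero hγ m).trans (ih (2 * γ) (by linarith))
    have hJ0 : 0 < J γ (m + 1) 0 := by
      rw [h0]; exact mul_pos (Cpos m) (Gpos m _ (by linarith))
    -- comparison function made globally nonnegative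
    have key : J γ (m + 1) a * |Gp γ (m + 1) 0| = |Gp γ (m + 1) a| * J γ (m + 1) 0 := by
      refine bm (F := J γ (m + 1)) (G := fun s => |Gp γ (m + 1) s|)
        (g := fun s => ∏ k ∈ Finset.range (m + 1), (s + 1 + k * γ)) hJ0
        (abs_pos.2 (Gpos _ 0 (by norm_num)).ne') (fun s hs => J_succ hγ hs (m + 1)) ?_ ?_
        (J_convex hγ (m + 1)) ?_ (J_nonneg γ (m + 1)) (fun s => abs_nonneg _) ?_ ha
      · intro s hs
        have h1 : 0 ≤ ∏ k ∈ Finset.range (m + 1), (s + 1 + k * γ) := Finset.prod_nonneg fun k _ => by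
          have : 0 ≤ k * γ := by positivity
          linarith
        rw [← abs_of_nonneg h1, ← abs_mul]
        congr 1
        unfold Gp
        rw [← Finset.prod_mul_distrib]
        refine Finset.prod_congr rfl fun k _ => ?_
        have : 0 ≤ k * γ := by positivity
        rw [show 1 + (s + 1) + k * γ = (s + 1 + k * γ) + 1 by ring, Gamma_add_one (by linarith)]
        congr 2
        ring
      · intro s hs
        refine Finset.prod_pos fun k _ => ?_
        have : 0 ≤ k * γ := by positivity
        linarith
      · intro s t θ η hs ht hθ hη h
        have hst : -1 < θ * s + η * t := by nlinarith
        rw [abs_of_pos (Gpos _ _ hs), abs_of_pos (Gpos _ _ ht), abs_of_pos (Gpos _ _ hst)]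
        unfold Gp
        have hnn : ∀ s, -1 < s → ∀ k ∈ Finset.range (m + 1), 0 < 1 + s + k * γ := fun s hs k _ => by
          have : 0 ≤ k * γ := by positivity
          linarith
        rw [← finsetProd_rpow _ _ (fun k hk => (Gamma_pos_of_pos (hnn s hs k hk)).le),
          ← finsetProd_rpow _ _ (fun k hk => (Gamma_pos_of_pos (hnn t ht k hk)).le), ← Finset.prod_mul_distrib]
        refine Finset.prod_le_prod (fun k hk => (Gamma_pos_of_pos (hnn _ hst k hk)).le) fun k hk => ?_
        have := Gamma_mul_add_mul_le_rpow_Gamma_mul_rpow_Gamma (hnn s hs k hk) (hnn t ht k hk) hθ hη h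
        refine le_trans (le_of_eq ?_) this
        congr 1
        have e : η = 1 - θ := by linarith
        rw [e]; ring
      · simp only [← Finset.prod_div_distrib]
        have : Tendsto (fun l : ℕ => ∏ k ∈ Finset.range (m + 1), ((l : ℝ) + 1 + 1 + k * γ) / (l + 1 + k * γ))
          atTop (𝓝 (∏ k ∈ Finset.range (m + 1), (1:ℝ))) := by
          refine tendsto_finsetProd _ fun k _ => ?_
          have hk : 0 ≤ k * γ := by positivity
          have e : ∀ l : ℕ, ((l : ℝ) + 1 + 1 + k * γ) / (l + 1 + k * γ) = 1 + 1 / (l + (1 + k * γ)) := by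
            intro l
            have : 0 < (l : ℝ) + 1 + k * γ := by positivity
            have h2 : 0 < (l : ℝ) + (1 + k * γ) := by positivity
            field_simp
            ring
          simp_rw [e]
          have h3 : Tendsto (fun l : ℕ => (l : ℝ) + (1 + k * γ)) atTop atTop :=
            tendsto_atTop_add_const_right _ _ tendsto_natCast_atTop_atTop
          have h4 := (h3.inv_tendsto_atTop).const_add (1:ℝ)
          simpa using h4
        simpa using this
    rw [abs_of_pos (Gpos _ _ ha), abs_of_pos (Gpos _ 0 (by norm_num)), h0] at key
    have hG0 := Gpos (m + 1) 0 (by norm_num)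
    refine mul_right_cancel₀ hG0.ne' ?_
    rw [key]
    have e1 : Gp γ (m + 1) 0 = ∏ k ∈ Finset.range m, Gamma (1 + ((k : ℝ) + 1) * γ) := by
      unfold Gp
      rw [Finset.prod_range_succ']
      simp
    have e2 : Gp γ m (2 * γ) * Gamma (1 + γ) = (∏ k ∈ Finset.range m, Gamma (1 + ((k : ℝ) + 1) * γ)) * Gamma (1 + (m + 1) * γ) := by
      rw [← Finset.prod_range_succ (fun k : ℕ => Gamma (1 + ((k : ℝ) + 1) * γ)), Finset.prod_range_succ']
      unfold Gp
      congr 1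
      · refine Finset.prod_congr rfl fun k _ => ?_
        congr 1
        push_cast
        ring
      · simp
    have hΓ : 0 < Gamma (1 + γ) := Gamma_pos_of_pos (by positivity)
    rw [e1, Finset.prod_range_succ]
    have e3 : Gp γ m (2 * γ) = (∏ k ∈ Finset.range m, Gamma (1 + ((k : ℝ) + 1) * γ)) * Gamma (1 + (m + 1) * γ) / Gamma (1 + γ) := by
      rw [← e2]; field_simp
    rw [e3]
    ring

lemma V_eq {N : ℕ} (β : ℝ) (x : Fin N → ℝ) :
    ∏ p ∈ Finset.univ.filter (fun p : Fin N × Fin N => p.1 < p.2), |x p.2 - x p.1| ^ β =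
      V (β / 2) 0 x := by
  rw [Finset.prod_filter, Fintype.prod_prod_type]
  unfold V
  have e : ∀ i j : Fin N, (if i = j then 1 else psi (β / 2) 0 (x i - x j)) =
      (if i < j then psi (β / 2) 0 (x i - x j) else 1) * (if j < i then psi (β / 2) 0 (x j - x i) else 1) := by
    intro i j
    rcases lt_trichotomy i j with h | h | h
    · simp [h, h.ne, h.not_gt]
    · simp [h]
    · rw [← neg_sub (x j), psi_even]
      simp [h, h.ne', h.not_gt]
  simp_rw [e, Finset.prod_mul_distrib]
  rw [Finset.prod_comm (f := fun i j : Fin N => if j < i then psi (β / 2) 0 (x j - x i) else 1)]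
  simp_rw [← Finset.prod_mul_distrib]
  refine Finset.prod_congr rfl fun i _ => Finset.prod_congr rfl fun j _ => ?_
  split_ifs
  · unfold psi
    rw [zero_pow two_ne_zero, add_zero, ← sq_abs, abs_sub_comm, ← rpow_natCast, ← rpow_mul (abs_nonneg _)]
    rw [← sq, ← rpow_natCast, ← rpow_mul (abs_nonneg _)]
    congr 1
    push_cast
    ring
  · simp

lemma V_smul {N : ℕ} (hN : 0 < N) (γ : ℝ) {R : ℝ} (hR : 0 < R) (x : Fin N → ℝ) :
    V γ 0 (R • x) = R ^ (γ * (N * (N - 1))) * V γ 0 x := by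
  have e : ∀ i j : Fin N, (if i = j then 1 else psi γ 0 ((R • x) i - (R • x) j)) =
      (if i = j then 1 else R ^ γ) * (if i = j then 1 else psi γ 0 (x i - x j)) := by
    intro i j
    split_ifs
    · simp
    · unfold psi
      simp only [Pi.smul_apply, smul_eq_mul]
      rw [← mul_sub, mul_pow, zero_pow two_ne_zero, add_zero, add_zero,
        mul_rpow (by positivity) (by positivity), ← rpow_natCast R, ← rpow_mul hR.le]
      congr 2
      push_cast
      ring
  unfold V
  simp_rw [e, Finset.prod_mul_distrib]
  congr 1
  have : ∀ i : Fin N, ∏ j, (if i = j then 1 else R ^ γ) = (R ^ γ) ^ (N - 1) := by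
    intro i
    rw [Finset.prod_ite]
    simp [Finset.filter_ne, Finset.card_erase_of_mem]
  simp_rw [this]
  rw [Finset.prod_const, Finset.card_univ, Fintype.card_fin, ← pow_mul, ← rpow_natCast, ← rpow_mul hR.le]
  congr 1
  rw [Nat.cast_mul, Nat.cast_sub hN]
  push_cast
  ring

open scoped Pointwise in
lemma smul_orthant (N : ℕ) {R : ℝ} (hR : 0 < R) :
    R • (Set.univ.pi (fun _ : Fin N => Set.Ioi (0 : ℝ))) =
      Set.univ.pi (fun _ : Fin N => Set.Ioi (0 : ℝ)) := by
  ext x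
  rw [Set.mem_smul_set_iff_inv_smul_mem₀ hR.ne']
  simp only [Set.mem_pi, Set.mem_univ, true_implies, Set.mem_Ioi, Pi.smul_apply, smul_eq_mul]
  exact forall_congr' fun i => mul_pos_iff_of_pos_left (inv_pos.2 hR)

end LagSel

/-- The Laguerre (Selberg) normalization integral of the Laguerre β-ensemble:
`∫_{(0,∞)^N} ∏ x_l^a e^{−βx_l/2} ∏_{j<k}|x_k − x_j|^β dx
 = (2/β)^{N(a+1+β(N−1)/2)} ∏_{j=1}^N Γ(1+jβ/2)Γ(1+a+(j−1)β/2)/Γ(1+β/2)`. -/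
theorem laguerre_selberg_normalization (N : ℕ) (hN : 0 < N) (a β : ℝ)
    (ha : -1 < a) (hβ : 0 < β) :
    (∫ x in Set.univ.pi (fun _ : Fin N => Set.Ioi (0 : ℝ)),
        (∏ l, (x l) ^ a * Real.exp (-β * x l / 2)) *
          ∏ p ∈ Finset.univ.filter (fun p : Fin N × Fin N => p.1 < p.2),
            |x p.2 - x p.1| ^ β) =
      (2 / β) ^ ((N : ℝ) * (a + 1 + β * ((N : ℝ) - 1) / 2)) *
        ∏ j ∈ Finset.Icc 1 N,
          Real.Gamma (1 + j * β / 2) * Real.Gamma (1 + a + ((j : ℝ) - 1) * β / 2) /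
            Real.Gamma (1 + β / 2) := by
  have hγ : 0 < β / 2 := by positivity
  have hR : 0 < 2 / β := by positivity
  simp_rw [LagSel.V_eq]
  have hs := Measure.setIntegral_comp_smul_of_pos (volume : Measure (Fin N → ℝ))
    (fun x => (∏ l, (x l) ^ a * Real.exp (-β * x l / 2)) * LagSel.V (β / 2) 0 x)
    (Set.univ.pi (fun _ : Fin N => Set.Ioi (0 : ℝ))) hR
  rw [LagSel.smul_orthant N hR] at hs
  have hJ : ∫ x in Set.univ.pi (fun _ : Fin N => Set.Ioi (0 : ℝ)),
      (fun x : Fin N → ℝ => (∏ l, (x l) ^ a * Real.exp (-β * x l / 2)) * LagSel.V (β / 2) 0 x)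
        ((2 / β) • x) =
      (2 / β) ^ (a * N + β / 2 * (N * (N - 1))) * LagSel.J (β / 2) N a := by
    unfold LagSel.J LagSel.I
    rw [LagSel.mu_eq, ← integral_const_mul]
    refine setIntegral_congr_fun (MeasurableSet.univ_pi (fun _ => measurableSet_Ioi)) fun x hx => ?_
    simp only
    rw [LagSel.V_smul hN _ hR, Real.rpow_add hR]
    have : ∏ l, ((2 / β) • x) l ^ a * Real.exp (-β * ((2 / β) • x) l / 2) =
        (2 / β) ^ (a * N) * LagSel.wt (fun _ => a) x := by
      have h1 : ∀ l, ((2 / β) • x) l ^ a * Real.exp (-β * ((2 / β) • x) l / 2) =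
          (2 / β) ^ a * (x l ^ a * Real.exp (-x l)) := by
        intro l
        have hl : 0 < x l := hx l (Set.mem_univ l)
        rw [Pi.smul_apply, smul_eq_mul, Real.mul_rpow hR.le hl.le, mul_assoc]
        congr 3
        field_simp
      simp_rw [h1]
      rw [Finset.prod_mul_distrib, Finset.prod_const, Finset.card_univ, Fintype.card_fin,
        ← Real.rpow_natCast, ← Real.rpow_mul hR.le]
      rfl
    rw [this]
    ring
  rw [hJ, Module.finrank_fin_fun, smul_eq_mul, eq_inv_mul_iff_mul_eq₀ (by positivity)] at hs
  rw [← hs, LagSel.J_eval hγ N a ha, ← mul_assoc, ← Real.rpow_natCast, ← Real.rpow_add hR,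
    LagSel.Gp, ← Finset.prod_mul_distrib]
  congr 1
  · congr 1
    ring
  · rw [← Finset.Ico_add_one_right_eq_Icc, Finset.prod_Ico_eq_prod_range]
    simp only [Nat.add_sub_cancel]
    refine Finset.prod_congr rfl fun k _ => ?_
    push_cast
    rw [show 1 + (1 + (k:ℝ)) * β / 2 = 1 + ((k:ℝ) + 1) * (β / 2) by ring,
      show 1 + a + (1 + (k:ℝ) - 1) * β / 2 = 1 + a + k * (β / 2) by ring]
    ring
end
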